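/- arXiv:2511.08312 — 2 statements merged into one kernel-verified Lean document; each statement's English description precedes it below -/
import Mathlib

section
/- The subgroup of GL₆(𝔽₂) generated by the matrices B and C acts simply transitively on the set {U₁,…,U₆}: for every pair of indices i, j ∈ {1,…,6} there exists exactly one element g of the subgroup generated by B and C such that the image of Uᵢ under left multiplication by g equals Uⱼ. -/
/-- The vector space `V = 𝔽₂⁶`. -/
abbrev V : Type := Fin 6 → ZMod 2

/-- The standard basis vectors of `V`. -/
def e (i : Fin 6) : V := Pi.single i 1

/-- The six 2-dimensional subspaces `U₁, …, U₆` of `V` (indexed by `Fin 6`). -/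
def U : Fin 6 → Submodule (ZMod 2) V :=
  ![Submodule.span (ZMod 2) {e 4, e 5},
    Submodule.span (ZMod 2) {e 0, e 1},
    Submodule.span (ZMod 2) {e 2, e 3},
    Submodule.span (ZMod 2) {e 0 + e 2 + e 4, e 1 + e 3 + e 4 + e 5},
    Submodule.span (ZMod 2) {e 0 + e 3 + e 5, e 1 + e 2 + e 3 + e 4},
    Submodule.span (ZMod 2) {e 1 + e 2 + e 5, e 0 + e 1 + e 3 + e 4}]

/-- The matrix `B` over `𝔽₂`. -/
def B : Matrix (Fin 6) (Fin 6) (ZMod 2) :=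
  !![1,0,1,1,0,1;
     1,1,0,1,1,1;
     1,1,1,1,1,0;
     0,1,0,1,0,1;
     1,1,1,0,0,1;
     1,0,0,1,1,0]

/-- The matrix `C` over `𝔽₂`. -/
def C : Matrix (Fin 6) (Fin 6) (ZMod 2) :=
  !![1,1,0,1,0,0;
     1,0,1,1,0,0;
     1,1,1,1,1,0;
     1,0,1,0,1,1;
     0,1,1,1,0,0;
     1,0,0,1,0,0]

/-- A basis of each of the subspaces `U i`. -/
def basisU : Fin 6 → V × V :=
  ![(e 4, e 5), (e 0, e 1), (e 2, e 3),
    (e 0 + e 2 + e 4, e 1 + e 3 + e 4 + e 5),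
    (e 0 + e 3 + e 5, e 1 + e 2 + e 3 + e 4),
    (e 1 + e 2 + e 5, e 0 + e 1 + e 3 + e 4)]

theorem U_eq_span (i : Fin 6) :
    U i = Submodule.span (ZMod 2) {(basisU i).1, (basisU i).2} := by
  fin_cases i <;> rfl

theorem U_injective : Function.Injective U := by
  intro i j h
  have hmem : (basisU i).1 ∈ U j := by
    rw [← h, U_eq_span]
    exact Submodule.subset_span (Set.mem_insert _ _)
  rw [U_eq_span, Submodule.mem_span_pair] at hmem
  have key : ∀ i j : Fin 6,
      (∃ s t : ZMod 2, s • (basisU j).1 + t • (basisU j).2 = (basisU i).1) → i = j := by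
    decide +kernel
  exact key i j hmem

theorem span_pair_le_span_pair {R M : Type*} [Semiring R] [AddCommMonoid M] [Module R M]
    {a b c d : M} (ha : ∃ s t : R, s • c + t • d = a) (hb : ∃ s t : R, s • c + t • d = b) :
    Submodule.span R {a, b} ≤ Submodule.span R {c, d} := by
  rw [Submodule.span_le, Set.pair_subset_iff]
  exact ⟨Submodule.mem_span_pair.2 ha, Submodule.mem_span_pair.2 hb⟩

theorem map_B_U (i : Fin 6) : (U i).map B.mulVecLin = U (![5, 4, 3, 2, 1, 0] i) := by
  rw [U_eq_span, U_eq_span, Submodule.map_span, Set.image_pair, Matrix.mulVecLin_apply,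
    Matrix.mulVecLin_apply]
  apply le_antisymm <;> apply span_pair_le_span_pair <;> revert i <;> decide +kernel

theorem map_C_U (i : Fin 6) : (U i).map C.mulVecLin = U (![2, 3, 4, 5, 0, 1] i) := by
  rw [U_eq_span, U_eq_span, Submodule.map_span, Set.image_pair, Matrix.mulVecLin_apply,
    Matrix.mulVecLin_apply]
  apply le_antisymm <;> apply span_pair_le_span_pair <;> revert i <;> decide +kernel

/-- The six elements of the group generated by `B` and `C`. -/
def groupElement : Fin 6 → Matrix (Fin 6) (Fin 6) (ZMod 2) :=
  ![1, B, C, B * C, C * B, C * C]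

/-- The permutation of the indices of `U₁, …, U₆` induced by `groupElement k`. -/
def indexAction : Fin 6 → Fin 6 → Fin 6 :=
  ![![0, 1, 2, 3, 4, 5], ![5, 4, 3, 2, 1, 0], ![2, 3, 4, 5, 0, 1],
    ![3, 2, 1, 0, 5, 4], ![1, 0, 5, 4, 3, 2], ![4, 5, 0, 1, 2, 3]]

theorem map_groupElement_U (k i : Fin 6) :
    (U i).map (groupElement k).mulVecLin = U (indexAction k i) := by
  fin_cases k <;>
    simp only [groupElement, Fin.zero_eta, Fin.mk_one, Fin.reduceFinMk, Matrix.cons_val,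
      Matrix.mulVecLin_one, Matrix.mulVecLin_mul, Submodule.map_id, Submodule.map_comp,
      map_B_U, map_C_U] <;>
    exact congrArg U (by revert i; decide)

theorem B_mul_groupElement (k : Fin 6) :
    B * groupElement k = groupElement (![1, 0, 3, 2, 5, 4] k) := by
  revert k; decide +kernel

theorem C_mul_groupElement (k : Fin 6) :
    C * groupElement k = groupElement (![2, 4, 5, 1, 3, 0] k) := by
  revert k; decide +kernel

theorem groupElement_mem_closure (k : Fin 6) :
    groupElement k ∈ Submonoid.closure {B, C} := by
  have hB : B ∈ Submonoid.closure {B, C} := Submonoid.subset_closure (by simp)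
  have hC : C ∈ Submonoid.closure {B, C} := Submonoid.subset_closure (by simp)
  fin_cases k
  exacts [one_mem _, hB, hC, mul_mem hB hC, mul_mem hC hB, mul_mem hC hC]

theorem exists_groupElement_eq {g : Matrix (Fin 6) (Fin 6) (ZMod 2)}
    (hg : g ∈ Submonoid.closure {B, C}) : ∃ k, groupElement k = g := by
  induction hg using Submonoid.closure_induction_left with
  | one => exact ⟨0, rfl⟩
  | mul_left x hx y _ ih =>
    obtain ⟨k, rfl⟩ := ih
    obtain rfl | rfl := hx
    exacts [⟨_, (B_mul_groupElement k).symm⟩, ⟨_, (C_mul_groupElement k).symm⟩]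

theorem existsUnique_indexAction (i j : Fin 6) : ∃! k, indexAction k i = j := by
  unfold ExistsUnique
  revert i j; decide

/-- The subgroup generated by `B` and `C` (realized as the multiplicative closure of
`{B, C}`, which is a group since the generated subgroup is finite) acts simply
transitively on `{U₁, …, U₆}`: for all `i, j` there is exactly one element `g` of the
generated group with `g · Uᵢ = Uⱼ`. -/
theorem stmt_6 :
    ∀ i j : Fin 6, ∃! g : Matrix (Fin 6) (Fin 6) (ZMod 2),
      g ∈ Submonoid.closure {B, C} ∧ (U i).map g.mulVecLin = U j := by
  intro i j
  obtain ⟨k, hk, hk_unique⟩ := existsUnique_indexAction i j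
  refine ⟨groupElement k, ⟨groupElement_mem_closure k, ?_⟩, ?_⟩
  · rw [map_groupElement_U, hk]
  · rintro g ⟨hg, hgU⟩
    obtain ⟨l, rfl⟩ := exists_groupElement_eq hg
    rw [map_groupElement_U] at hgU
    rw [hk_unique l (U_injective hgU)]
end

section
/- The presented group L₇ = ⟨a₁, a₂, b | a₁², a₂², (a₁a₂)², b⁶, (a₂ b a₂ b⁻¹)², (a₁ b a₂ b⁻¹)², (a₂ b a₁ b⁻¹)², (a₁ b a₁ b⁻¹)², a₁ b a₂ b a₁ b² a₂ b², (a₁ b a₁ b²)², a₂ b a₂ b a₁ a₂ b a₁ b³⟩ is isomorphic to the subgroup of the group of permutations of 𝔽₂⁶ generated by all translations x ↦ x + v (v ∈ 𝔽₂⁶) together with the linear bijection x ↦ A·x; in particular L₇ has order 384. -/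
/-- The matrix `A` over `𝔽₂`. -/
def A : Matrix (Fin 6) (Fin 6) (ZMod 2) :=
  !![0,0,1,1,1,1;
     0,0,0,1,1,0;
     1,1,1,1,1,0;
     0,1,0,1,0,1;
     0,0,1,0,1,0;
     0,0,0,1,1,1]

/-- The generator `a₁` of the free group on three generators `a₁, a₂, b`. -/
def a₁ : FreeGroup (Fin 3) := FreeGroup.of 0
/-- The generator `a₂`. -/
def a₂ : FreeGroup (Fin 3) := FreeGroup.of 1
/-- The generator `b`. -/
def b : FreeGroup (Fin 3) := FreeGroup.of 2

/-- The relators of the presentation of `L₇`. -/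
def rels₇ : Set (FreeGroup (Fin 3)) :=
  {a₁ ^ 2, a₂ ^ 2, (a₁ * a₂) ^ 2, b ^ 6,
   (a₂ * b * a₂ * b⁻¹) ^ 2, (a₁ * b * a₂ * b⁻¹) ^ 2,
   (a₂ * b * a₁ * b⁻¹) ^ 2, (a₁ * b * a₁ * b⁻¹) ^ 2,
   a₁ * b * a₂ * b * a₁ * b ^ 2 * a₂ * b ^ 2,
   (a₁ * b * a₁ * b ^ 2) ^ 2,
   a₂ * b * a₂ * b * a₁ * a₂ * b * a₁ * b ^ 3}

/-- The presented group `L₇`. -/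
abbrev L₇ : Type := PresentedGroup rels₇

/-- The generating set of the target subgroup of `Perm(𝔽₂⁶)`: all translations
`x ↦ x + v` together with the linear bijection `x ↦ A·x`. -/
def TransA : Set (Equiv.Perm V) :=
  {π | (∃ v : V, ∀ x, π x = x + v) ∨ (∀ x, π x = A.mulVec x)}

section Involutions

variable {G : Type*} [Group G]

lemma commute_of_sq_eq_one {p q : G} (hp : p ^ 2 = 1) (hq : q ^ 2 = 1) (h : (p * q) ^ 2 = 1) :
    Commute p q := by
  have hp' : p⁻¹ = p := inv_eq_of_mul_eq_one_left (by rwa [pow_two] at hp)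
  have hq' : q⁻¹ = q := inv_eq_of_mul_eq_one_left (by rwa [pow_two] at hq)
  rw [pow_two] at h
  have := eq_inv_of_mul_eq_one_left h
  rwa [mul_inv_rev, hp', hq'] at this

/-- A finite family of pairwise commuting involutions extends to a homomorphism from an elementary
abelian `2`-group. -/
lemma exists_addMonoidHom_of_involutions {n : ℕ} (g : Fin n → G) (hg : ∀ i, g i ^ 2 = 1)
    (hc : ∀ i j, Commute (g i) (g j)) :
    ∃ θ : (Fin n → ZMod 2) →+ Additive G, ∀ i, θ (Pi.single i 1) = Additive.ofMul (g i) := by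
  let ϕ (i : Fin n) : ZMod 2 →+ Additive G :=
    ZMod.lift 2 ⟨zmultiplesHom (Additive G) (Additive.ofMul (g i)), by
      simpa [← ofMul_zpow, ← ofMul_pow] using congrArg Additive.ofMul (hg i)⟩
  have hϕ (i : Fin n) (s : ZMod 2) : ϕ i s = Additive.ofMul (g i ^ s.val) := by
    conv_lhs => rw [← ZMod.natCast_zmod_val s]
    rw [← Int.cast_natCast, ZMod.lift_coe]
    simp [-ZMod.natCast_val]
  have hcomm : Pairwise fun i j ↦ ∀ s t, AddCommute (ϕ i s) (ϕ j t) := fun i j _ s t ↦ by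
    rw [hϕ, hϕ]
    exact congrArg Additive.ofMul ((hc i j).pow_pow _ _).eq
  refine ⟨AddMonoidHom.noncommPiCoprod ϕ hcomm, fun i ↦ ?_⟩
  rw [AddMonoidHom.noncommPiCoprod_single, hϕ]
  simp [ZMod.val_one]

lemma addMonoidHom_eq_of_single {n : ℕ} {M : Type*} [AddMonoid M] {f g : (Fin n → ZMod 2) →+ M}
    (h : ∀ i, f (Pi.single i 1) = g (Pi.single i 1)) : f = g := by
  refine AddMonoidHom.noncommPiCoprodEquiv.symm.injective (Subtype.ext (funext fun i ↦ ?_))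
  ext s
  fin_cases s
  · exact (map_zero _).trans (map_zero _).symm
  · exact h i

end Involutions

/-- The relations between the conjugates `x k = bᵏ a₁ b⁻ᵏ` and `y k = bᵏ a₂ b⁻ᵏ` in a group
satisfying the relators of `L₇`. -/
structure ConjugateRelations {G : Type*} [Group G] (x y : ℕ → G) : Prop where
  x_sq (k) : x k ^ 2 = 1
  y_sq (k) : y k ^ 2 = 1
  x_period (k) : x (k + 6) = x k
  y_period (k) : y (k + 6) = y k
  x_y (k) : Commute (x k) (y k)
  x_x_succ (k) : Commute (x k) (x (k + 1))
  y_y_succ (k) : Commute (y k) (y (k + 1))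
  x_y_succ (k) : Commute (x k) (y (k + 1))
  y_x_succ (k) : Commute (y k) (x (k + 1))
  xyxy (k) : x k * y (k + 1) * x (k + 2) * y (k + 4) = 1
  xxxx (k) : x k * x (k + 1) * x (k + 3) * x (k + 4) = 1
  yyxyx (k) : y k * y (k + 1) * x (k + 2) * y (k + 2) * x (k + 3) = 1

namespace ConjugateRelations

variable {G : Type*} [Group G] {x y : ℕ → G}

lemma x_inv (h : ConjugateRelations x y) (k : ℕ) : (x k)⁻¹ = x k :=
  inv_eq_of_mul_eq_one_left (by rw [← pow_two, h.x_sq])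

lemma y_inv (h : ConjugateRelations x y) (k : ℕ) : (y k)⁻¹ = y k :=
  inv_eq_of_mul_eq_one_left (by rw [← pow_two, h.y_sq])

lemma y_add_four (h : ConjugateRelations x y) (k : ℕ) :
    y (k + 4) = x k * y (k + 1) * x (k + 2) := by
  rw [← h.y_inv, inv_eq_of_mul_eq_one_left (h.xyxy k)]

lemma x_add_three (h : ConjugateRelations x y) (k : ℕ) :
    x (k + 3) = y k * y (k + 1) * x (k + 2) * y (k + 2) := by
  rw [← h.x_inv, inv_eq_of_mul_eq_one_left (h.yyxyx k)]

lemma x_add_four (h : ConjugateRelations x y) (k : ℕ) :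
    x (k + 4) = x k * x (k + 1) * x (k + 3) := by
  rw [← h.x_inv, inv_eq_of_mul_eq_one_left (h.xxxx k)]

lemma x_x_add_two (h : ConjugateRelations x y) (k : ℕ) : Commute (x k) (x (k + 2)) := by
  have e : x k * y (k + 1) * x (k + 2) = x (k + 2) * (y (k + 1) * x k) := by
    rw [← h.y_add_four, ← h.y_inv, h.y_add_four]
    simp only [mul_inv_rev, h.x_inv, h.y_inv]
  rw [(h.x_y_succ k).eq, mul_assoc, (h.y_x_succ (k + 1)).symm.left_comm] at e
  exact mul_left_cancel e

lemma x_x_add_four (h : ConjugateRelations x y) (k : ℕ) : Commute (x k) (x (k + 4)) := by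
  simpa only [h.x_period] using (h.x_x_add_two (k + 4)).symm

lemma x_x_add_three (h : ConjugateRelations x y) (k : ℕ) : Commute (x k) (x (k + 3)) := by
  have e : x (k + 3) = x (k + 4) * (x k * x (k + 1)) := by
    rw [← mul_left_inj (x (k + 3)), ← pow_two, h.x_sq, mul_assoc, ← h.x_add_four, ← pow_two, h.x_sq]
  rw [e]
  exact (h.x_x_add_four k).mul_right ((Commute.refl _).mul_right (h.x_x_succ k))

lemma y_add_one (h : ConjugateRelations x y) (k : ℕ) :
    y (k + 1) = x k * y (k + 4) * x (k + 2) := by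
  rw [h.y_add_four, mul_assoc, mul_assoc, ← pow_two, h.x_sq, mul_one, ← mul_assoc, ← pow_two,
    h.x_sq, one_mul]

lemma y_x_add_two (h : ConjugateRelations x y) (k : ℕ) : Commute (y k) (x (k + 2)) := by
  have e : Commute (y (k + 5 + 1)) (x (k + 5 + 3)) := by
    rw [h.y_add_one]
    exact ((h.x_x_add_three _).mul_left (h.x_y_succ (k + 5 + 3)).symm).mul_left
      (h.x_x_succ (k + 5 + 2))
  rwa [h.y_period k, h.x_period (k + 2)] at e

lemma x_y_add_two (h : ConjugateRelations x y) (k : ℕ) : Commute (x k) (y (k + 2)) := by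
  have e : Commute (x (k + 1 + 5)) (y (k + 1 + 1)) := by
    rw [h.y_add_one]
    refine (Commute.mul_right ?_ (h.y_x_succ (k + 1 + 4)).symm).mul_right
      (h.x_x_add_three (k + 1 + 2)).symm
    simpa only [h.x_period] using h.x_x_succ k
  rwa [h.x_period k] at e

lemma y_y_add_two (h : ConjugateRelations x y) (k : ℕ) : Commute (y k) (y (k + 2)) := by
  have e : y k * y (k + 1) * x (k + 2) * y (k + 2) = y (k + 2) * x (k + 2) * y (k + 1) * y k := by
    rw [← h.x_add_three, ← h.x_inv, h.x_add_three]
    simp only [mul_inv_rev, h.x_inv, h.y_inv, mul_assoc]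
  have c₁ : Commute (y k) (y (k + 1) * x (k + 2)) := (h.y_y_succ k).mul_right (h.y_x_add_two k)
  have c₂ : Commute (y (k + 2)) (x (k + 2) * y (k + 1)) :=
    (h.x_y _).symm.mul_right (h.y_y_succ (k + 1)).symm
  rw [mul_assoc (y k), c₁.eq, mul_assoc (y (k + 2)), c₂.eq, (h.y_x_succ (k + 1)).eq, mul_assoc,
    mul_assoc _ _ (y k)] at e
  exact mul_left_cancel e

lemma y_add_three (h : ConjugateRelations x y) (k : ℕ) :
    y (k + 3) = x (k + 5) * y k * x (k + 1) := by
  have e := h.y_add_four (k + 5)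
  rwa [h.y_period (k + 3), h.y_period k, h.x_period (k + 1)] at e

end ConjugateRelations

lemma forall_mem_rels₇_iff {G : Type*} [Group G] (f : FreeGroup (Fin 3) →* G) :
    (∀ r ∈ rels₇, f r = 1) ↔
      f a₁ ^ 2 = 1 ∧ f a₂ ^ 2 = 1 ∧ (f a₁ * f a₂) ^ 2 = 1 ∧ f b ^ 6 = 1 ∧
      (f a₂ * f b * f a₂ * (f b)⁻¹) ^ 2 = 1 ∧ (f a₁ * f b * f a₂ * (f b)⁻¹) ^ 2 = 1 ∧
      (f a₂ * f b * f a₁ * (f b)⁻¹) ^ 2 = 1 ∧ (f a₁ * f b * f a₁ * (f b)⁻¹) ^ 2 = 1 ∧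
      f a₁ * f b * f a₂ * f b * f a₁ * f b ^ 2 * f a₂ * f b ^ 2 = 1 ∧
      (f a₁ * f b * f a₁ * f b ^ 2) ^ 2 = 1 ∧
      f a₂ * f b * f a₂ * f b * f a₁ * f a₂ * f b * f a₁ * f b ^ 3 = 1 := by
  simp only [rels₇, Set.mem_insert_iff, Set.mem_singleton_iff, forall_eq_or_imp, forall_eq, map_mul,
    map_pow, map_inv]

lemma conjugateRelations_of_relators {G : Type*} [Group G] {p q c : G}
    (hp : p ^ 2 = 1) (hq : q ^ 2 = 1) (hpq : (p * q) ^ 2 = 1) (hc : c ^ 6 = 1)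
    (hqq : (q * c * q * c⁻¹) ^ 2 = 1) (hpcq : (p * c * q * c⁻¹) ^ 2 = 1)
    (hqcp : (q * c * p * c⁻¹) ^ 2 = 1) (hpp : (p * c * p * c⁻¹) ^ 2 = 1)
    (h₁ : p * c * q * c * p * c ^ 2 * q * c ^ 2 = 1)
    (h₂ : (p * c * p * c ^ 2) ^ 2 = 1)
    (h₃ : q * c * q * c * p * q * c * p * c ^ 3 = 1) :
    ConjugateRelations (fun k ↦ MulAut.conj (c ^ k) p) (fun k ↦ MulAut.conj (c ^ k) q) := by
  have shift (k j : ℕ) (g : G) :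
      MulAut.conj (c ^ (k + j)) g = MulAut.conj (c ^ k) (MulAut.conj (c ^ j) g) := by
    rw [pow_add, map_mul, MulAut.mul_apply]
  have sq (k : ℕ) {g : G} (hg : g ^ 2 = 1) : MulAut.conj (c ^ k) g ^ 2 = 1 := by
    rw [← map_pow, hg, map_one]
  have succ {g g' : G} (hg : g ^ 2 = 1) (hg' : g' ^ 2 = 1) (hgg' : (g * c * g' * c⁻¹) ^ 2 = 1)
      (k : ℕ) : Commute (MulAut.conj (c ^ k) g) (MulAut.conj (c ^ (k + 1)) g') := by
    rw [shift]
    refine (commute_of_sq_eq_one hg (sq 1 hg') ?_).map _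
    simpa [mul_assoc] using hgg'
  have period (k : ℕ) (g : G) : MulAut.conj (c ^ (k + 6)) g = MulAut.conj (c ^ k) g := by
    rw [pow_add, hc, mul_one]
  have of_zero (k : ℕ) {g : G} (hg : g = 1) : MulAut.conj (c ^ k) g = 1 := by rw [hg, map_one]
  refine ⟨fun k ↦ sq k hp, fun k ↦ sq k hq, fun k ↦ period k p, fun k ↦ period k q,
    fun k ↦ (commute_of_sq_eq_one hp hq hpq).map _, succ hp hp hpp, succ hq hq hqq,
    succ hp hq hpcq, succ hq hp hqcp, fun k ↦ ?_, fun k ↦ ?_, fun k ↦ ?_⟩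
  all_goals simp only [shift, ← map_mul]; refine of_zero k ?_
  · calc _ = p * c * q * c * p * c ^ 2 * q * c ^ 2 * (c ^ 6)⁻¹ := by
          simp only [MulAut.conj_apply]; group
      _ = 1 := by rw [h₁, hc]; simp
  · calc _ = (p * c * p * c ^ 2) ^ 2 * (c ^ 6)⁻¹ := by
          simp only [MulAut.conj_apply, pow_two (_ * _)]; group
      _ = 1 := by rw [h₂, hc]; simp
  · calc _ = q * c * q * c * p * q * c * p * c ^ 3 * (c ^ 6)⁻¹ := by
          simp only [MulAut.conj_apply]; group
      _ = 1 := by rw [h₃, hc]; simp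

lemma A_pow_six : A ^ 6 = 1 := by decide +kernel

/-- The translation homomorphism `v ↦ (x ↦ v + x)` of `V`. -/
def translation : V →+ Additive (Equiv.Perm V) where
  toFun v := Additive.ofMul (Equiv.addLeft v)
  map_zero' := by ext; simp
  map_add' v w := by ext; simp

/-- The linear bijection `x ↦ A·x` of `V`. -/
def linearPerm : Equiv.Perm V where
  toFun x := A.mulVec x
  invFun x := (A ^ 5).mulVec x
  left_inv x := by
    simp only [Matrix.mulVec_mulVec, ← pow_succ, Nat.reduceAdd, A_pow_six, Matrix.one_mulVec]
  right_inv x := by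
    simp only [Matrix.mulVec_mulVec, ← pow_succ', Nat.reduceAdd, A_pow_six, Matrix.one_mulVec]

lemma linearPerm_pow_apply (n : ℕ) (x : V) : (linearPerm ^ n) x = (A ^ n).mulVec x := by
  induction n with
  | zero => simp
  | succ n ih => rw [pow_succ', pow_succ', Equiv.Perm.mul_apply, ih, ← Matrix.mulVec_mulVec]; rfl

lemma linearPerm_pow_six : linearPerm ^ 6 = 1 := by
  ext1 x
  rw [linearPerm_pow_apply, A_pow_six, Matrix.one_mulVec, Equiv.Perm.one_apply]

lemma linearPerm_mul_addLeft (v : V) :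
    linearPerm * Equiv.addLeft v = Equiv.addLeft (A.mulVec v) * linearPerm := by
  ext1 x
  exact Matrix.mulVec_add A v x

lemma A_mulVec (p q r s t u : ZMod 2) :
    A.mulVec ![p, q, r, s, t, u] =
      ![r + (s + (t + u)), s + t, p + (q + (r + (s + t))), q + (s + u), r + t, s + (t + u)] := by
  ext i
  fin_cases i <;> simp [A, Matrix.mulVec, dotProduct, Fin.sum_univ_succ]

/-- The images of the generators `a₁, a₂, b` of `L₇` in the permutation group of `V`. -/
def generatorPerm : Fin 3 → Equiv.Perm V :=
  ![Equiv.addLeft ![0, 0, 0, 0, 1, 0], Equiv.addLeft ![0, 0, 0, 0, 0, 1], linearPerm]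

lemma lift_generatorPerm_eq_one : ∀ r ∈ rels₇, FreeGroup.lift generatorPerm r = 1 := by
  have inv : linearPerm⁻¹ = linearPerm ^ 5 :=
    inv_eq_of_mul_eq_one_left ((pow_succ _ _).symm.trans linearPerm_pow_six)
  have push (v : V) (g : Equiv.Perm V) : linearPerm * (Equiv.addLeft v * g) =
      Equiv.addLeft (A.mulVec v) * (linearPerm * g) := by
    rw [← mul_assoc, linearPerm_mul_addLeft, mul_assoc]
  have merge (v w : V) : Equiv.addLeft v * Equiv.addLeft w = Equiv.addLeft (v + w) := by
    ext1; simp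
  have merge' (v w : V) (g : Equiv.Perm V) :
      Equiv.addLeft v * (Equiv.addLeft w * g) = Equiv.addLeft (v + w) * g := by
    rw [← mul_assoc, merge]
  have cycle (g : Equiv.Perm V) : linearPerm * (linearPerm * (linearPerm * (linearPerm *
      (linearPerm * (linearPerm * g))))) = g := by
    simpa only [pow_succ, pow_zero, one_mul, mul_assoc] using congrArg (· * g) linearPerm_pow_six
  have cycle' : linearPerm * (linearPerm * (linearPerm * (linearPerm *
      (linearPerm * linearPerm)))) = 1 := by simpa using cycle 1
  have zero : Equiv.addLeft (![0, 0, 0, 0, 0, 0] : V) = 1 := by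
    ext1 x
    have : (![0, 0, 0, 0, 0, 0] : V) = 0 := by decide
    simp [this]
  have two : (1 : ZMod 2) + 1 = 0 := by decide
  rw [forall_mem_rels₇_iff]
  simp only [a₁, a₂, b, FreeGroup.lift_apply_of]
  simp [generatorPerm, inv, pow_succ, mul_assoc, push, linearPerm_mul_addLeft, merge, merge',
    A_mulVec, cycle', two, zero]

/-- The matrix of conjugation by `b` in the basis `a₁, b a₁ b⁻¹, b² a₁ b⁻², a₂, b a₂ b⁻¹, b² a₂ b⁻²`
of the normal closure of `a₁, a₂`. -/
def conjMatrix : Matrix (Fin 6) (Fin 6) (ZMod 2) :=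
  !![0,0,0,0,0,1;
     1,0,0,0,0,1;
     0,1,1,0,0,0;
     0,0,1,0,0,0;
     0,0,1,1,0,1;
     0,0,1,0,1,1]

/-- The matrix with columns `u, A·u, A²·u, w, A·w, A²·w`, where `u` and `w` are the last two vectors
of the standard basis. -/
def basisMatrix : Matrix (Fin 6) (Fin 6) (ZMod 2) :=
  !![0,1,1,0,1,0;
     0,1,1,0,0,1;
     0,1,0,0,0,0;
     0,0,0,0,1,0;
     1,1,0,0,0,0;
     0,1,0,1,1,0]

/-- The inverse of `basisMatrix`. -/
def basisMatrixInv : Matrix (Fin 6) (Fin 6) (ZMod 2) :=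
  !![0,0,1,0,1,0;
     0,0,1,0,0,0;
     1,0,1,1,0,0;
     0,0,1,1,0,1;
     0,0,0,1,0,0;
     1,1,0,1,0,0]

lemma basisMatrix_mul_inv : basisMatrix * basisMatrixInv = 1 := by decide +kernel

lemma exists_addMonoidHom_of_conjugateRelations {G : Type*} [Group G] {p q c : G}
    (h : ConjugateRelations (fun k ↦ MulAut.conj (c ^ k) p) (fun k ↦ MulAut.conj (c ^ k) q)) :
    ∃ θ : V →+ Additive G,
      (∀ i, θ (Pi.single i 1) = Additive.ofMul
        (![p, MulAut.conj c p, MulAut.conj (c ^ 2) p, q, MulAut.conj c q, MulAut.conj (c ^ 2) q]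
          i)) ∧
      ∀ v, MulAut.conj c (θ v).toMul = (θ (conjMatrix.mulVec v)).toMul := by
  set x : ℕ → G := fun k ↦ MulAut.conj (c ^ k) p with hx
  set y : ℕ → G := fun k ↦ MulAut.conj (c ^ k) q with hy
  have x_succ (k : ℕ) : MulAut.conj c (x k) = x (k + 1) := by
    simp only [hx, pow_succ', map_mul, MulAut.mul_apply]
  have y_succ (k : ℕ) : MulAut.conj c (y k) = y (k + 1) := by
    simp only [hy, pow_succ', map_mul, MulAut.mul_apply]
  have hg : ![p, MulAut.conj c p, MulAut.conj (c ^ 2) p, q, MulAut.conj c q,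
      MulAut.conj (c ^ 2) q] = ![x 0, x 1, x 2, y 0, y 1, y 2] := by simp [hx, hy]
  rw [hg]
  obtain ⟨θ, hθ⟩ := exists_addMonoidHom_of_involutions ![x 0, x 1, x 2, y 0, y 1, y 2]
    (by simp [Fin.forall_fin_succ, h.x_sq, h.y_sq])
    (by
      simp [Fin.forall_fin_succ, Commute.refl, h.x_x_succ, (h.x_x_succ _).symm, h.x_x_add_two 0,
        (h.x_x_add_two 0).symm, h.y_y_succ, (h.y_y_succ _).symm, h.y_y_add_two 0,
        (h.y_y_add_two 0).symm, h.x_y, (h.x_y _).symm, h.x_y_succ, (h.x_y_succ _).symm,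
        h.y_x_succ, (h.y_x_succ _).symm, h.x_y_add_two 0, (h.x_y_add_two 0).symm,
        h.y_x_add_two 0, (h.y_x_add_two 0).symm])
  refine ⟨θ, hθ, fun v ↦ ?_⟩
  have θx3 : θ (conjMatrix.mulVec (Pi.single 2 1)) = Additive.ofMul (x 3) := by
    rw [show conjMatrix.mulVec (Pi.single 2 1) =
        Pi.single 3 1 + Pi.single 4 1 + Pi.single 2 1 + Pi.single 5 1 by decide +kernel]
    simp only [map_add, hθ]
    exact congrArg Additive.ofMul (h.x_add_three 0).symm
  have θy3 : θ (conjMatrix.mulVec (Pi.single 5 1)) = Additive.ofMul (y 3) := by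
    rw [show conjMatrix.mulVec (Pi.single 5 1) =
        Pi.single 1 1 + Pi.single 2 1 + (Pi.single 0 1 + Pi.single 1 1 +
          conjMatrix.mulVec (Pi.single 2 1)) + Pi.single 3 1 + Pi.single 1 1 by decide +kernel]
    have e : y 3 = x 1 * x 2 * (x 0 * x 1 * x 3) * y 0 * x 1 :=
      (h.y_add_three 0).trans <| by rw [h.x_add_four 1, h.x_add_four 0]
    simp only [map_add, hθ, θx3, e]
    rfl
  have key : (MulAut.conj c).toMonoidHom.toAdditive.comp θ =
      θ.comp (Matrix.mulVecLin conjMatrix).toAddMonoidHom := by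
    refine addMonoidHom_eq_of_single fun i ↦ ?_
    change Additive.ofMul (MulAut.conj c (θ (Pi.single i 1)).toMul) =
      θ (conjMatrix.mulVec (Pi.single i 1))
    rw [hθ]
    match i with
    | 0 =>
      rw [show conjMatrix.mulVec (Pi.single 0 1) = Pi.single 1 1 by decide +kernel, hθ]
      exact congrArg Additive.ofMul (x_succ 0)
    | 1 =>
      rw [show conjMatrix.mulVec (Pi.single 1 1) = Pi.single 2 1 by decide +kernel, hθ]
      exact congrArg Additive.ofMul (x_succ 1)
    | 2 =>
      exact (congrArg Additive.ofMul (x_succ 2)).trans θx3.symm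
    | 3 =>
      rw [show conjMatrix.mulVec (Pi.single 3 1) = Pi.single 4 1 by decide +kernel, hθ]
      exact congrArg Additive.ofMul (y_succ 0)
    | 4 =>
      rw [show conjMatrix.mulVec (Pi.single 4 1) = Pi.single 5 1 by decide +kernel, hθ]
      exact congrArg Additive.ofMul (y_succ 1)
    | 5 =>
      exact (congrArg Additive.ofMul (y_succ 2)).trans θy3.symm
  exact congrArg Additive.toMul (DFunLike.congr_fun key v)

lemma exists_eq_mul_pow {G : Type*} [Group G] {p q c : G}
    (hG : Subgroup.closure {p, q, c} = ⊤) (hp : p ^ 2 = 1) (hq : q ^ 2 = 1) (hc : c ^ 6 = 1)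
    (θ : V →+ Additive G) (hθp : θ (Pi.single 0 1) = Additive.ofMul p)
    (hθq : θ (Pi.single 3 1) = Additive.ofMul q)
    (hθ : ∀ v, MulAut.conj c (θ v).toMul = (θ (conjMatrix.mulVec v)).toMul) (g : G) :
    ∃ (v : V) (k : Fin 6), (θ v).toMul * c ^ (k : ℕ) = g := by
  suffices ∃ (v : V) (k : ℕ), (θ v).toMul * c ^ k = g by
    obtain ⟨v, k, rfl⟩ := this
    exact ⟨v, ⟨k % 6, Nat.mod_lt _ (by norm_num)⟩, by rw [← pow_eq_pow_mod k hc]⟩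
  have hC : Submonoid.closure {p, q, c} = ⊤ := by
    rw [← Subgroup.closure_toSubmonoid_of_isOfFinOrder, hG, Subgroup.top_toSubmonoid]
    rintro s (rfl | rfl | rfl)
    · exact isOfFinOrder_iff_pow_eq_one.2 ⟨2, by norm_num, hp⟩
    · exact isOfFinOrder_iff_pow_eq_one.2 ⟨2, by norm_num, hq⟩
    · exact isOfFinOrder_iff_pow_eq_one.2 ⟨6, by norm_num, hc⟩
  induction g using Submonoid.induction_of_closure_eq_top_left hC with
  | one => exact ⟨0, 0, by simp⟩
  | mul_left s hs g ih =>
    obtain ⟨v, k, rfl⟩ := ih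
    rcases hs with rfl | rfl | rfl
    · exact ⟨Pi.single 0 1 + v, k, by rw [map_add, hθp, toMul_add, toMul_ofMul, mul_assoc]⟩
    · exact ⟨Pi.single 3 1 + v, k, by rw [map_add, hθq, toMul_add, toMul_ofMul, mul_assoc]⟩
    · exact ⟨conjMatrix.mulVec v, k + 1, by rw [← hθ, MulAut.conj_apply, pow_succ']; group⟩

/-- The homomorphism from `L₇` to the permutation group of `V` given by `generatorPerm`. -/
def toPerm : L₇ →* Equiv.Perm V := PresentedGroup.toGroup lift_generatorPerm_eq_one

lemma translation_mul_linearPerm_pow_injective :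
    Function.Injective fun vk : V × Fin 6 ↦
      (translation vk.1).toMul * linearPerm ^ (vk.2 : ℕ) := by
  rintro ⟨v, j⟩ ⟨w, k⟩ h
  have h₀ : v = w := by
    simpa [translation, linearPerm_pow_apply] using DFunLike.congr_fun h 0
  subst h₀
  have hpow : linearPerm ^ (j : ℕ) = linearPerm ^ (k : ℕ) := mul_left_cancel h
  have h₁ : (A ^ (j : ℕ)).mulVec ![0, 0, 0, 0, 1, 0] = (A ^ (k : ℕ)).mulVec ![0, 0, 0, 0, 1, 0] := by
    rw [← linearPerm_pow_apply, ← linearPerm_pow_apply, hpow]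
  have inj : ∀ j k : Fin 6, (A ^ (j : ℕ)).mulVec ![0, 0, 0, 0, 1, 0] =
      (A ^ (k : ℕ)).mulVec ![0, 0, 0, 0, 1, 0] → j = k := by decide +kernel
  rw [inj j k h₁]

/-- The presented group `L₇` is isomorphic to the subgroup of the permutation group of
`𝔽₂⁶` generated by the translations together with `x ↦ A·x`; in particular `L₇` has
order 384. -/
theorem stmt_16 :
    Nonempty (L₇ ≃* (Subgroup.closure TransA : Subgroup (Equiv.Perm V))) ∧
    Nat.card L₇ = 384 := by
  obtain ⟨hp, hq, hpq, hc, hqq, hpcq, hqcp, hpp, h₁, h₂, h₃⟩ :=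
    (forall_mem_rels₇_iff (PresentedGroup.mk rels₇)).1 fun _ ↦ PresentedGroup.one_of_mem
  set p : L₇ := PresentedGroup.mk rels₇ a₁
  set q : L₇ := PresentedGroup.mk rels₇ a₂
  set c : L₇ := PresentedGroup.mk rels₇ b
  have φp : toPerm p = Equiv.addLeft ![0, 0, 0, 0, 1, 0] := PresentedGroup.toGroup.of _
  have φq : toPerm q = Equiv.addLeft ![0, 0, 0, 0, 0, 1] := PresentedGroup.toGroup.of _
  have φc : toPerm c = linearPerm := PresentedGroup.toGroup.of _
  have hG : Subgroup.closure {p, q, c} = ⊤ := by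
    rw [← PresentedGroup.closure_range_of]
    congr 1
    ext g
    simp [Fin.exists_fin_succ, eq_comm]
    rfl
  obtain ⟨θ, hθ, hconj⟩ := exists_addMonoidHom_of_conjugateRelations
    (conjugateRelations_of_relators hp hq hpq hc hqq hpcq hqcp hpp h₁ h₂ h₃)
  have surj := exists_eq_mul_pow hG hp hq hc θ (hθ 0) (hθ 3) hconj
  have hφc (v : V) : linearPerm * Equiv.addLeft v * linearPerm⁻¹ = Equiv.addLeft (A.mulVec v) := by
    rw [linearPerm_mul_addLeft, mul_inv_cancel_right]
  have hφθ (v : V) : toPerm (θ v).toMul = Equiv.addLeft (basisMatrix.mulVec v) := by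
    have : toPerm.toAdditive.comp θ =
        translation.comp (Matrix.mulVecLin basisMatrix).toAddMonoidHom := by
      refine addMonoidHom_eq_of_single fun i ↦ ?_
      change Additive.ofMul (toPerm (θ (Pi.single i 1)).toMul) =
        Additive.ofMul (Equiv.addLeft (basisMatrix.mulVec (Pi.single i 1)))
      rw [hθ, toMul_ofMul]
      congr 1
      fin_cases i <;>
        simp [φp, φq, φc, pow_two, hφc] <;>
        congr 1 <;> decide +kernel
    exact congrArg Additive.toMul (DFunLike.congr_fun this v)
  let f : V × Fin 6 → L₇ := fun vk ↦ (θ vk.1).toMul * c ^ (vk.2 : ℕ)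
  have hf : Function.Surjective f := fun g ↦ by
    obtain ⟨v, k, rfl⟩ := surj g
    exact ⟨(v, k), rfl⟩
  have hφf : Function.Injective (toPerm ∘ f) := by
    have : Function.Injective (Prod.map basisMatrix.mulVec id : V × Fin 6 → V × Fin 6) :=
      (Matrix.mulVec_injective_of_isUnit (IsUnit.of_mul_eq_one _ basisMatrix_mul_inv)).prodMap
        Function.injective_id
    convert translation_mul_linearPerm_pow_injective.comp this using 1
    ext1 vk
    simp only [f, Function.comp_apply, map_mul, map_pow, hφθ, φc]
    rfl
  have inj : Function.Injective toPerm := hφf.of_comp_right hf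
  have range : toPerm.range = Subgroup.closure TransA := by
    apply le_antisymm
    · rw [MonoidHom.range_eq_map, ← hG, MonoidHom.map_closure, Subgroup.closure_le]
      rintro _ ⟨g, rfl | rfl | rfl, rfl⟩
      · exact Subgroup.subset_closure (.inl ⟨_, fun x ↦ by rw [φp]; exact add_comm _ _⟩)
      · exact Subgroup.subset_closure (.inl ⟨_, fun x ↦ by rw [φq]; exact add_comm _ _⟩)
      · exact Subgroup.subset_closure (.inr fun x ↦ by rw [φc]; rfl)
    · rw [Subgroup.closure_le]
      rintro π (⟨v, hv⟩ | hπ)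
      · refine ⟨(θ (basisMatrixInv.mulVec v)).toMul, ?_⟩
        rw [hφθ, Matrix.mulVec_mulVec, basisMatrix_mul_inv, Matrix.one_mulVec]
        ext1 x
        rw [hv, add_comm]
        rfl
      · exact ⟨c, by rw [φc]; ext1 x; exact (hπ x).symm⟩
  refine ⟨⟨(MonoidHom.ofInjective inj).trans (MulEquiv.subgroupCongr range)⟩, ?_⟩
  rw [← Nat.card_eq_of_bijective f ⟨hφf.of_comp, hf⟩, Nat.card_eq_fintype_card]
  simp [ZMod.card]
end
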